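/- Let v, w : ℝ² → ℝ be continuously differentiable functions of (x,t) satisfying the linearly degenerate system v_t = w v_x and w_t = v w_x at every point, with w − v nowhere vanishing, and let φ : ℝ → ℝ be continuously differentiable. Then the characteristic-integral identity ∂_t(φ(v)/(w − v)) = ∂_x(w · φ(v)/(w − v)) holds at every point; i.e. the 1-form (φ(v)/(w − v))(dx + w dt) is closed on solutions. -/

import Mathlib

/-- The linearly degenerate system `v_t = w v_x`, `w_t = v w_x` possesses functionally
many characteristic integrals: for any `C¹` function `φ`, the 1-form
`(φ(v)/(w - v))(dx + w dt)` is closed on solutions, i.e.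
`∂_t(φ(v)/(w - v)) = ∂_x(w φ(v)/(w - v))`. -/
theorem two_component_system_characteristic_integrals
    (v w : ℝ × ℝ → ℝ) (hv : ContDiff ℝ 1 v) (hw : ContDiff ℝ 1 w)
    (hsys1 : ∀ x t : ℝ,
      deriv (fun s => v (x, s)) t = w (x, t) * deriv (fun s => v (s, t)) x)
    (hsys2 : ∀ x t : ℝ,
      deriv (fun s => w (x, s)) t = v (x, t) * deriv (fun s => w (s, t)) x)
    (hwv : ∀ x t : ℝ, w (x, t) - v (x, t) ≠ 0)
    (φ : ℝ → ℝ) (hφ : ContDiff ℝ 1 φ) :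
    ∀ x t : ℝ,
      deriv (fun s => φ (v (x, s)) / (w (x, s) - v (x, s))) t
        = deriv (fun s => w (s, t) * φ (v (s, t)) / (w (s, t) - v (s, t))) x := by
  intro x t
  have diff_t : ∀ f : ℝ × ℝ → ℝ, ContDiff ℝ 1 f →
      DifferentiableAt ℝ (fun s => f (x, s)) t := fun f hf =>
    ((hf.comp (contDiff_const.prodMk contDiff_id)).differentiable one_ne_zero) t
  have diff_x : ∀ f : ℝ × ℝ → ℝ, ContDiff ℝ 1 f →
      DifferentiableAt ℝ (fun s => f (s, t)) x := fun f hf =>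
    ((hf.comp (contDiff_id.prodMk contDiff_const)).differentiable one_ne_zero) x
  have hvt := (diff_t v hv).hasDerivAt
  have hwt := (diff_t w hw).hasDerivAt
  have hvx := (diff_x v hv).hasDerivAt
  have hwx := (diff_x w hw).hasDerivAt
  have hφv := (hφ.differentiable one_ne_zero (v (x, t))).hasDerivAt
  have hφt : HasDerivAt (fun s => φ (v (x, s))) _ t := hφv.comp t hvt
  have hφx : HasDerivAt (fun s => φ (v (s, t))) _ x := hφv.comp x hvx
  have hd := hwv x t
  have lhs := (hφt.fun_div (hwt.fun_sub hvt) hd).deriv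
  have rhs := ((hwx.fun_mul hφx).fun_div (hwx.fun_sub hvx) hd).deriv
  rw [lhs, rhs, hsys1, hsys2]
  congr 1
  ring
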